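/- arXiv:0912.3865 — 2 statements merged into one kernel-verified Lean document; each statement's English description precedes it below -/
import Mathlib

section
/- Let H ∈ (1/2, 1) and let μ be a nonnegative Borel measure on ℝ^d. Then the following are equivalent: (i) for every t > 0, J_t := ∫_{ℝ^d} A_t(|ξ|) μ(dξ) < ∞; (ii) ∫_{ℝ^d} (1/(1+|ξ|²))^{2H} μ(dξ) < ∞. (Analytic core of Theorem 4.1: necessary and sufficient condition for the existence of the solution of the linear stochastic heat equation with fractional-in-time noise) -/
open MeasureTheory Real

theorem integral_truncated_rpow_abs_sub {p δ : ℝ} (hp : -1 < p) (hδ : 0 < δ) (u : ℝ) :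
    ∫ v, (Set.Iic δ).indicator (fun w : ℝ => w ^ p) |u - v| = 2 * (δ ^ (p + 1) / (p + 1)) := by
  rw [integral_sub_left_eq_self (fun w => (Set.Iic δ).indicator (fun w : ℝ => w ^ p) |w|) volume u,
    integral_comp_abs, setIntegral_indicator measurableSet_Iic, Set.Ioi_inter_Iic,
    ← intervalIntegral.integral_of_le hδ.le, integral_rpow (Or.inl hp),
    zero_rpow (by linarith), sub_zero]

theorem integrable_truncated_rpow_abs_sub {p δ : ℝ} (hp : -1 < p) (hδ : 0 < δ) (u : ℝ) :
    Integrable fun v : ℝ => (Set.Iic δ).indicator (fun w : ℝ => w ^ p) |u - v| := by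
  refine Integrable.of_integral_ne_zero ?_
  rw [integral_truncated_rpow_abs_sub hp hδ]
  have : 0 < p + 1 := by linarith
  positivity

theorem rpow_le_truncated_add {p δ : ℝ} (hp : p ≤ 0) (hδ : 0 < δ) {e w : ℝ} (hw : 0 ≤ w)
    (he : 0 ≤ e) (he' : e ≤ 1) :
    e * w ^ p ≤ (Set.Iic δ).indicator (fun w : ℝ => w ^ p) w + δ ^ p * e := by
  by_cases h : w ≤ δ
  · rw [Set.indicator_of_mem (Set.mem_Iic.2 h)]
    have h1 : e * w ^ p ≤ 1 * w ^ p := by gcongr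
    have h2 : 0 ≤ δ ^ p * e := by positivity
    linarith
  · rw [Set.indicator_of_notMem (by simpa using h), zero_add, mul_comm]
    exact mul_le_mul_of_nonneg_right (rpow_le_rpow_of_nonpos hδ (not_le.1 h).le hp) he

theorem setIntegral_exp_neg_mul_le {c : ℝ} (hc : 0 < c) (t : ℝ) :
    ∫ v in Set.Ioc 0 t, exp (-c * v) ≤ 1 / c := by
  calc ∫ v in Set.Ioc 0 t, exp (-c * v) ≤ ∫ v in Set.Ioi 0, exp (-c * v) :=
        setIntegral_mono_set (exp_neg_integrableOn_Ioi 0 hc)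
          (Filter.Eventually.of_forall fun _ => (exp_pos _).le)
          (Set.Ioc_subset_Ioi_self).eventuallyLE
    _ = 1 / c := by
        rw [integral_exp_mul_Ioi (neg_lt_zero.2 hc)]
        simp

/-- The integrand defining `A_t(√s)` up to the factor `α_H`, with `p = 2H - 2`. -/
noncomputable def heatKernelIntegrand (p s u v : ℝ) : ℝ :=
  exp (-(u * s) / 2) * exp (-(v * s) / 2) * |u - v| ^ p

theorem heatKernelIntegrand_nonneg (p s u v : ℝ) : 0 ≤ heatKernelIntegrand p s u v := by
  unfold heatKernelIntegrand; positivity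

theorem measurable_heatKernelIntegrand (p s : ℝ) :
    Measurable (Function.uncurry (heatKernelIntegrand p s)) := by
  unfold heatKernelIntegrand Function.uncurry
  fun_prop

/-- An integrable majorant of `heatKernelIntegrand p s u` on `(0, t]`. -/
noncomputable def heatKernelMajorant (p s t u v : ℝ) : ℝ :=
  exp t * exp (-((1 + s) / 2) * u) *
    ((Set.Iic (1 + s)⁻¹).indicator (fun w : ℝ => w ^ p) |u - v| +
      (1 + s)⁻¹ ^ p * exp (-((1 + s) / 2) * v))

section Bounds

variable {p s t u v : ℝ}

theorem heatKernelIntegrand_le_majorant (hp0 : p ≤ 0) (hs : 0 ≤ s) (hu : u ∈ Set.Ioc 0 t)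
    (hv : v ∈ Set.Ioc 0 t) : heatKernelIntegrand p s u v ≤ heatKernelMajorant p s t u v := by
  have hb : 0 < 1 + s := by linarith
  have hv1 : exp (-((1 + s) / 2) * v) ≤ 1 := exp_le_one_iff.2 (by nlinarith [hv.1])
  have h1 := rpow_le_truncated_add hp0 (inv_pos.2 hb) (abs_nonneg (u - v)) (exp_pos _).le hv1
  have h2 : exp (-(u * s) / 2) * exp (-(v * s) / 2) ≤
      exp t * exp (-((1 + s) / 2) * u) * exp (-((1 + s) / 2) * v) := by
    rw [← exp_add, ← exp_add, ← exp_add, exp_le_exp]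
    linarith [hu.2, hv.2]
  calc heatKernelIntegrand p s u v
      ≤ exp t * exp (-((1 + s) / 2) * u) * exp (-((1 + s) / 2) * v) * |u - v| ^ p :=
        mul_le_mul_of_nonneg_right h2 (by positivity)
    _ = exp t * exp (-((1 + s) / 2) * u) * (exp (-((1 + s) / 2) * v) * |u - v| ^ p) := by ring
    _ ≤ _ := mul_le_mul_of_nonneg_left h1 (by positivity)

theorem integrableOn_exp_neg_mul (c : ℝ) : IntegrableOn (fun v => exp (-c * v)) (Set.Ioc 0 t) :=
  (by fun_prop : Continuous fun v => exp (-c * v)).integrableOn_Ioc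

theorem integrableOn_heatKernelMajorant (hp : -1 < p) (hs : 0 ≤ s) :
    IntegrableOn (heatKernelMajorant p s t u) (Set.Ioc 0 t) :=
  ((integrable_truncated_rpow_abs_sub hp (inv_pos.2 (by linarith)) u).integrableOn.add
    ((integrableOn_exp_neg_mul _).const_mul _)).const_mul _

theorem integrableOn_heatKernelIntegrand (hp : -1 < p) (hp0 : p ≤ 0) (hs : 0 ≤ s)
    (hu : u ∈ Set.Ioc 0 t) : IntegrableOn (heatKernelIntegrand p s u) (Set.Ioc 0 t) := by
  refine (integrableOn_heatKernelMajorant hp hs (u := u)).mono'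
    ((measurable_heatKernelIntegrand p s).of_uncurry_left.aestronglyMeasurable) ?_
  refine (ae_restrict_iff' measurableSet_Ioc).2 (Filter.Eventually.of_forall fun v hv => ?_)
  rw [norm_of_nonneg (heatKernelIntegrand_nonneg p s u v)]
  exact heatKernelIntegrand_le_majorant hp0 hs hu hv

theorem setIntegral_heatKernelIntegrand_le (hp : -1 < p) (hp0 : p ≤ 0) (hs : 0 ≤ s)
    (hu : u ∈ Set.Ioc 0 t) :
    ∫ v in Set.Ioc 0 t, heatKernelIntegrand p s u v ≤
      exp t * (2 / (p + 1) + 2) * (1 + s) ^ (-(p + 1)) * exp (-((1 + s) / 2) * u) := by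
  have hb : 0 < 1 + s := by linarith
  have hp1 : 0 < p + 1 := by linarith
  have hpow : (1 + s)⁻¹ ^ (p + 1) = (1 + s) ^ (-(p + 1)) := by
    rw [inv_rpow hb.le, rpow_neg hb.le]
  have hind : ∫ v in Set.Ioc 0 t, (Set.Iic (1 + s)⁻¹).indicator (fun w : ℝ => w ^ p) |u - v| ≤
      2 * ((1 + s) ^ (-(p + 1)) / (p + 1)) := by
    rw [← hpow, ← integral_truncated_rpow_abs_sub hp (inv_pos.2 hb) u]
    refine setIntegral_le_integral (integrable_truncated_rpow_abs_sub hp (inv_pos.2 hb) u)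
      (Filter.Eventually.of_forall fun v => ?_)
    exact Set.indicator_apply_nonneg fun _ => rpow_nonneg (abs_nonneg _) _
  have hexp : (1 + s)⁻¹ ^ p * ∫ v in Set.Ioc 0 t, exp (-((1 + s) / 2) * v) ≤
      2 * (1 + s) ^ (-(p + 1)) := by
    calc _ ≤ (1 + s)⁻¹ ^ p * (1 / ((1 + s) / 2)) := by
          gcongr
          exact setIntegral_exp_neg_mul_le (half_pos hb) t
      _ = _ := by
          rw [← hpow, rpow_add_one (inv_pos.2 hb).ne']
          field_simp
  calc ∫ v in Set.Ioc 0 t, heatKernelIntegrand p s u v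
      ≤ ∫ v in Set.Ioc 0 t, heatKernelMajorant p s t u v :=
        setIntegral_mono_on (integrableOn_heatKernelIntegrand hp hp0 hs hu)
          (integrableOn_heatKernelMajorant hp hs) measurableSet_Ioc
          fun v hv => heatKernelIntegrand_le_majorant hp0 hs hu hv
    _ ≤ exp t * exp (-((1 + s) / 2) * u) *
        (2 * ((1 + s) ^ (-(p + 1)) / (p + 1)) + 2 * (1 + s) ^ (-(p + 1))) := by
        unfold heatKernelMajorant
        rw [integral_const_mul, integral_add
          (integrable_truncated_rpow_abs_sub hp (inv_pos.2 hb) u).integrableOn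
          ((integrableOn_exp_neg_mul _).const_mul _), integral_const_mul]
        gcongr
    _ = _ := by ring

theorem integrableOn_setIntegral_heatKernelIntegrand (hp : -1 < p) (hp0 : p ≤ 0) (hs : 0 ≤ s) :
    IntegrableOn (fun u => ∫ v in Set.Ioc 0 t, heatKernelIntegrand p s u v) (Set.Ioc 0 t) := by
  refine ((integrableOn_exp_neg_mul ((1 + s) / 2)).const_mul
    (exp t * (2 / (p + 1) + 2) * (1 + s) ^ (-(p + 1)))).mono'
    (measurable_heatKernelIntegrand p s).stronglyMeasurable.integral_prod_right.aestronglyMeasurable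
    ?_
  refine (ae_restrict_iff' measurableSet_Ioc).2 (Filter.Eventually.of_forall fun u hu => ?_)
  rw [norm_of_nonneg (integral_nonneg fun v => heatKernelIntegrand_nonneg p s u v)]
  exact setIntegral_heatKernelIntegrand_le hp hp0 hs hu

theorem setIntegral_setIntegral_heatKernelIntegrand_le (hp : -1 < p) (hp0 : p ≤ 0) (hs : 0 ≤ s) :
    ∫ u in Set.Ioc 0 t, ∫ v in Set.Ioc 0 t, heatKernelIntegrand p s u v ≤
      exp t * (2 / (p + 1) + 2) * 2 * (1 + s) ^ (-(p + 2)) := by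
  have hb : 0 < 1 + s := by linarith
  have hp1 : 0 < p + 1 := by linarith
  calc _ ≤ ∫ u in Set.Ioc 0 t,
        exp t * (2 / (p + 1) + 2) * (1 + s) ^ (-(p + 1)) * exp (-((1 + s) / 2) * u) :=
        setIntegral_mono_on (integrableOn_setIntegral_heatKernelIntegrand hp hp0 hs)
          ((integrableOn_exp_neg_mul _).const_mul _) measurableSet_Ioc
          fun u hu => setIntegral_heatKernelIntegrand_le hp hp0 hs hu
    _ ≤ exp t * (2 / (p + 1) + 2) * (1 + s) ^ (-(p + 1)) * (1 / ((1 + s) / 2)) := by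
        rw [integral_const_mul]
        gcongr
        exact setIntegral_exp_neg_mul_le (half_pos hb) t
    _ = _ := by
        rw [show -(p + 2) = -(p + 1) - 1 by ring, rpow_sub_one hb.ne']
        field_simp

theorem le_heatKernelIntegrand (hp0 : p ≤ 0) (hs : 0 ≤ s)
    (hu : u ∈ Set.Ioc 0 (t / (1 + s))) (hv : v ∈ Set.Ioc 0 (t / (1 + s))) (huv : v ≠ u) :
    exp (-t) * (t / (1 + s)) ^ p ≤ heatKernelIntegrand p s u v := by
  have hb : 0 < 1 + s := by linarith
  have hsmul : ∀ w ∈ Set.Ioc 0 (t / (1 + s)), w * s ≤ t := fun w hw => by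
    have := (le_div_iff₀ hb).1 hw.2
    nlinarith [hw.1]
  have hpow : (t / (1 + s)) ^ p ≤ |u - v| ^ p :=
    rpow_le_rpow_of_nonpos (abs_pos.2 (sub_ne_zero.2 huv.symm))
      (abs_le.2 ⟨by linarith [hu.1, hv.2], by linarith [hu.2, hv.1]⟩) hp0
  have ht : 0 ≤ t / (1 + s) := hu.1.le.trans hu.2
  unfold heatKernelIntegrand
  rw [← exp_add]
  gcongr
  linarith [hsmul u hu, hsmul v hv]

theorem le_setIntegral_setIntegral_heatKernelIntegrand (hp : -1 < p) (hp0 : p ≤ 0) (hs : 0 ≤ s)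
    (ht : 0 < t) :
    exp (-t) * t ^ (p + 2) * (1 + s) ^ (-(p + 2)) ≤
      ∫ u in Set.Ioc 0 t, ∫ v in Set.Ioc 0 t, heatKernelIntegrand p s u v := by
  have hb : 0 < 1 + s := by linarith
  set r := t / (1 + s) with hr
  have hr0 : 0 < r := by positivity
  have hsub : Set.Ioc 0 r ⊆ Set.Ioc 0 t :=
    Set.Ioc_subset_Ioc_right (div_le_self ht.le (by linarith))
  have hinner : ∀ u ∈ Set.Ioc 0 r,
      exp (-t) * r ^ p * r ≤ ∫ v in Set.Ioc 0 t, heatKernelIntegrand p s u v := fun u hu => by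
    have hf := integrableOn_heatKernelIntegrand hp hp0 hs (hsub hu)
    calc exp (-t) * r ^ p * r = ∫ _ in Set.Ioc 0 r, exp (-t) * r ^ p := by
          simp [hr0.le, mul_comm]
      _ ≤ ∫ v in Set.Ioc 0 r, heatKernelIntegrand p s u v := by
          refine setIntegral_mono_on_ae (integrableOn_const measure_Ioc_lt_top.ne)
            (hf.mono_set hsub) measurableSet_Ioc ?_
          filter_upwards [Measure.ae_ne volume u] with v huv hv
          exact le_heatKernelIntegrand hp0 hs hu hv huv
      _ ≤ _ := setIntegral_mono_set hf
          (Filter.Eventually.of_forall fun v => heatKernelIntegrand_nonneg p s u v)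
          hsub.eventuallyLE
  have hf := integrableOn_setIntegral_heatKernelIntegrand hp hp0 hs (t := t)
  calc exp (-t) * t ^ (p + 2) * (1 + s) ^ (-(p + 2)) = exp (-t) * r ^ p * r * r := by
        have : r ^ (p + 2) = r ^ p * r * r := by
          rw [rpow_add hr0, rpow_two]; ring
        rw [mul_assoc, mul_assoc, mul_assoc, ← mul_assoc (r ^ p), ← this, hr,
          div_rpow ht.le hb.le, rpow_neg hb.le, div_eq_mul_inv]
    _ = ∫ _ in Set.Ioc 0 r, exp (-t) * r ^ p * r := by
        simp [hr0.le, mul_comm]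
    _ ≤ ∫ u in Set.Ioc 0 r, ∫ v in Set.Ioc 0 t, heatKernelIntegrand p s u v :=
        setIntegral_mono_on (integrableOn_const measure_Ioc_lt_top.ne)
          (hf.mono_set hsub) measurableSet_Ioc hinner
    _ ≤ _ := setIntegral_mono_set hf
        (Filter.Eventually.of_forall fun u =>
          integral_nonneg fun v => heatKernelIntegrand_nonneg p s u v)
        hsub.eventuallyLE

end Bounds

theorem lintegral_ofReal_lt_top_of_le_const_mul {α : Type*} [MeasurableSpace α] {μ : Measure α}
    {f g : α → ℝ} {C : ℝ} (hC : 0 ≤ C) (hfg : ∀ x, f x ≤ C * g x)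
    (hg : ∫⁻ x, ENNReal.ofReal (g x) ∂μ < ⊤) : ∫⁻ x, ENNReal.ofReal (f x) ∂μ < ⊤ :=
  calc ∫⁻ x, ENNReal.ofReal (f x) ∂μ ≤ ∫⁻ x, ENNReal.ofReal C * ENNReal.ofReal (g x) ∂μ :=
        lintegral_mono fun x => by
          rw [← ENNReal.ofReal_mul hC]
          exact ENNReal.ofReal_le_ofReal (hfg x)
    _ = ENNReal.ofReal C * ∫⁻ x, ENNReal.ofReal (g x) ∂μ :=
        lintegral_const_mul' _ _ ENNReal.ofReal_ne_top
    _ < ⊤ := ENNReal.mul_lt_top ENNReal.ofReal_lt_top hg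

/-- Analytic core of Theorem 4.1: the solution of the linear stochastic heat equation
with fractional-in-time noise exists iff condition (9) holds. -/
theorem heat_existence_iff (H : ℝ) (hH : H ∈ Set.Ioo (1/2 : ℝ) 1) (d : ℕ)
    (μ : Measure (EuclideanSpace ℝ (Fin d))) :
    (∀ t : ℝ, 0 < t →
      ∫⁻ ξ, ENNReal.ofReal (H * (2 * H - 1) *
        ∫ u in (0 : ℝ)..t, ∫ v in (0 : ℝ)..t,
          Real.exp (-(u * ‖ξ‖ ^ 2) / 2) * Real.exp (-(v * ‖ξ‖ ^ 2) / 2) *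
            |u - v| ^ (2 * H - 2)) ∂μ < ⊤) ↔
    ∫⁻ ξ, ENNReal.ofReal ((1 / (1 + ‖ξ‖ ^ 2)) ^ (2 * H)) ∂μ < ⊤ := by
  obtain ⟨hH1, hH2⟩ := hH
  have hp : -1 < 2 * H - 2 := by linarith
  have hp0 : 2 * H - 2 ≤ 0 := by linarith
  have hα : 0 < H * (2 * H - 1) := mul_pos (by linarith) (by linarith)
  have hpow : ∀ ξ : EuclideanSpace ℝ (Fin d),
      (1 / (1 + ‖ξ‖ ^ 2)) ^ (2 * H) = (1 + ‖ξ‖ ^ 2) ^ (-(2 * H - 2 + 2)) := fun ξ => by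
    rw [one_div, inv_rpow (by positivity), ← rpow_neg (by positivity), sub_add_cancel]
  have hset : ∀ t : ℝ, 0 < t → ∀ ξ : EuclideanSpace ℝ (Fin d),
      ∫ u in (0 : ℝ)..t, ∫ v in (0 : ℝ)..t,
          Real.exp (-(u * ‖ξ‖ ^ 2) / 2) * Real.exp (-(v * ‖ξ‖ ^ 2) / 2) *
            |u - v| ^ (2 * H - 2) =
        ∫ u in Set.Ioc 0 t, ∫ v in Set.Ioc 0 t,
          heatKernelIntegrand (2 * H - 2) (‖ξ‖ ^ 2) u v := fun t ht ξ => by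
    simp only [intervalIntegral.integral_of_le ht.le, heatKernelIntegrand]
  constructor
  · intro h
    have hc : 0 < H * (2 * H - 1) * (exp (-1) * 1 ^ (2 * H - 2 + 2)) := by positivity
    refine lintegral_ofReal_lt_top_of_le_const_mul (inv_nonneg.2 hc.le) (fun ξ => ?_)
      (h 1 one_pos)
    rw [hset 1 one_pos, hpow, le_inv_mul_iff₀ hc, mul_assoc]
    exact mul_le_mul_of_nonneg_left (le_setIntegral_setIntegral_heatKernelIntegrand hp hp0
      (sq_nonneg ‖ξ‖) one_pos) hα.le
  · intro h t ht
    have hp1 : 0 < 2 * H - 2 + 1 := by linarith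
    refine lintegral_ofReal_lt_top_of_le_const_mul
      (C := H * (2 * H - 1) * (exp t * (2 / (2 * H - 2 + 1) + 2) * 2)) (by positivity)
      (fun ξ => ?_) h
    rw [hset t ht, hpow, mul_assoc (H * (2 * H - 1))]
    exact mul_le_mul_of_nonneg_left
      (setIntegral_setIntegral_heatKernelIntegrand_le hp hp0 (sq_nonneg ‖ξ‖)) hα.le
end

section
/- Let H ∈ (1/2, 1), d ≥ 1, and H_1, …, H_d ∈ (1/2, 1). Then ∫_{ℝ^d} (1/(1+|ξ|²))^{2H} · ∏_{i=1}^d |ξ_i|^{−(2H_i−1)} dξ < ∞ if and only if ∑_{i=1}^d (2H_i − 1) > d − 4H. (Remark 4.2 (i): fractional Brownian field case of condition (9) for the heat equation) -/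
open MeasureTheory Real

theorem lintegral_ofReal_eq_of_integral_eq {α : Type*} [MeasurableSpace α] {μ : Measure α}
    {f : α → ℝ} {c : ℝ} (hf : 0 ≤ᵐ[μ] f) (hc : c ≠ 0) (h : ∫ x, f x ∂μ = c) :
    ∫⁻ x, ENNReal.ofReal (f x) ∂μ = ENNReal.ofReal c := by
  rw [← h, ofReal_integral_eq_lintegral_ofReal (.of_integral_ne_zero (h ▸ hc)) hf]

theorem lintegral_rpow_mul_exp_neg_mul_Ioi {s r : ℝ} (hs : 0 < s) (hr : 0 < r) :
    ∫⁻ t in Set.Ioi (0 : ℝ), ENNReal.ofReal (t ^ (s - 1) * exp (-(r * t))) =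
      ENNReal.ofReal ((1 / r) ^ s * Gamma s) := by
  have := Gamma_pos_of_pos hs
  refine lintegral_ofReal_eq_of_integral_eq ?_ (by positivity)
    (integral_rpow_mul_exp_neg_mul_Ioi hs hr)
  filter_upwards [self_mem_ae_restrict measurableSet_Ioi] with t (ht : 0 < t)
  positivity

theorem integral_abs_rpow_mul_exp_neg_mul_sq {a t : ℝ} (ha : a < 1) (ht : 0 < t) :
    ∫ x : ℝ, |x| ^ (-a) * exp (-(t * x ^ 2)) = t ^ (-((1 - a) / 2)) * Gamma ((1 - a) / 2) := by
  have h := integral_comp_abs (f := fun x : ℝ => x ^ (-a) * exp (-(t * x ^ 2)))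
  simp only [sq_abs] at h
  have h2 := integral_rpow_mul_exp_neg_mul_rpow (p := 2) (q := -a) two_pos (by linarith) ht
  simp only [rpow_two, neg_mul] at h2
  rw [h, h2, show -(-a + 1) / 2 = -((1 - a) / 2) by ring, show (-a + 1) / 2 = (1 - a) / 2 by ring]
  ring

theorem lintegral_rpow_mul_exp_neg_Ioi_lt_top_iff {b : ℝ} :
    ∫⁻ t in Set.Ioi (0 : ℝ), ENNReal.ofReal (t ^ (b - 1) * exp (-t)) < ⊤ ↔ 0 < b := by
  constructor
  · intro h
    have hint : IntegrableOn (fun t : ℝ => t ^ (b - 1) * exp (-t)) (Set.Ioi 0) := by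
      refine (lintegral_ofReal_ne_top_iff_integrable (by fun_prop) ?_).1 h.ne
      filter_upwards [self_mem_ae_restrict measurableSet_Ioi] with t (ht : 0 < t)
      positivity
    have h1 : IntegrableOn (fun t : ℝ => t ^ (b - 1)) (Set.Ioo 0 1) := by
      refine ((hint.mono_set Set.Ioo_subset_Ioi_self).const_mul (exp 1)).mono'
        (by fun_prop) ?_
      filter_upwards [self_mem_ae_restrict measurableSet_Ioo] with t ht
      have h0 : 0 ≤ t ^ (b - 1) := rpow_nonneg ht.1.le _
      have h2 : 1 ≤ exp 1 * exp (-t) := by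
        rw [← exp_add]
        exact one_le_exp (by linarith [ht.2])
      rw [norm_of_nonneg h0]
      nlinarith
    have := (intervalIntegral.integrableOn_Ioo_rpow_iff one_pos).1 h1
    linarith
  · intro hb
    have := lintegral_rpow_mul_exp_neg_mul_Ioi hb one_pos
    simp only [one_mul] at this
    rw [this]
    exact ENNReal.ofReal_lt_top

theorem lintegral_pi_prod_abs_rpow_mul_exp_neg_mul_sq {ι : Type*} [Fintype ι] {a : ι → ℝ} {t : ℝ}
    (ha : ∀ i, a i < 1) (ht : 0 < t) :
    ∫⁻ x : ι → ℝ, ENNReal.ofReal (∏ i, (|x i| ^ (-a i) * exp (-(t * x i ^ 2)))) =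
      ENNReal.ofReal (t ^ (-∑ i, (1 - a i) / 2) * ∏ i, Gamma ((1 - a i) / 2)) := by
  have hG : ∀ i, 0 < Gamma ((1 - a i) / 2) := fun i =>
    Gamma_pos_of_pos (by linarith [ha i])
  have hP : 0 < ∏ i, Gamma ((1 - a i) / 2) := Finset.prod_pos fun i _ => hG i
  refine lintegral_ofReal_eq_of_integral_eq (ae_of_all _ fun x => ?_) (by positivity) ?_
  · exact Finset.prod_nonneg fun i _ => by positivity
  · rw [volume_pi, integral_fintype_prod_eq_prod (fun i (x : ℝ) => |x| ^ (-a i) * exp (-(t * x ^ 2)))]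
    simp only [integral_abs_rpow_mul_exp_neg_mul_sq (ha _) ht]
    rw [Finset.prod_mul_distrib, ← rpow_sum_of_pos ht, Finset.sum_neg_distrib]

theorem lintegral_one_add_norm_sq_rpow_mul_prod_abs_rpow {ι : Type*} [Fintype ι] {a : ι → ℝ}
    {s : ℝ} (ha : ∀ i, a i < 1) (hs : 0 < s) :
    ENNReal.ofReal (Gamma s) * ∫⁻ ξ : EuclideanSpace ℝ ι,
        ENNReal.ofReal ((1 / (1 + ‖ξ‖ ^ 2)) ^ s * ∏ i, |ξ i| ^ (-a i)) =
      ENNReal.ofReal (∏ i, Gamma ((1 - a i) / 2)) * ∫⁻ t in Set.Ioi (0 : ℝ),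
        ENNReal.ofReal (t ^ (s - ∑ i, (1 - a i) / 2 - 1) * exp (-t)) := by
  have hP : 0 ≤ ∏ i, Gamma ((1 - a i) / 2) :=
    Finset.prod_nonneg fun i _ => (Gamma_pos_of_pos (by linarith [ha i])).le
  rw [← (PiLp.volume_preserving_toLp ι).lintegral_comp_emb
    (MeasurableEquiv.toLp 2 _).measurableEmbedding,
    ← lintegral_const_mul' _ _ ENNReal.ofReal_ne_top,
    ← lintegral_const_mul' _ _ ENNReal.ofReal_ne_top]
  have hswap := lintegral_lintegral_swap (μ := (volume : Measure (ι → ℝ)))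
    (ν := volume.restrict (Set.Ioi (0 : ℝ))) (f := fun x t => ENNReal.ofReal
      (t ^ (s - 1) * exp (-((1 + ∑ i, x i ^ 2) * t)) * ∏ i, |x i| ^ (-a i)))
    (by unfold Function.uncurry; fun_prop)
  convert hswap using 1
  · refine lintegral_congr fun x => ?_
    have hx : 0 ≤ ∏ i, |x i| ^ (-a i) := Finset.prod_nonneg fun i _ => by positivity
    have hr : 0 < 1 + ∑ i, x i ^ 2 := by positivity
    simp_rw [ENNReal.ofReal_mul' hx]
    rw [lintegral_mul_const' _ _ ENNReal.ofReal_ne_top, lintegral_rpow_mul_exp_neg_mul_Ioi hs hr,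
      ← mul_assoc, ← ENNReal.ofReal_mul (Gamma_pos_of_pos hs).le, mul_comm (Gamma s),
      EuclideanSpace.real_norm_sq_eq]
  · refine setLIntegral_congr_fun measurableSet_Ioi fun t (ht : 0 < t) => ?_
    have hfac : ∀ x : ι → ℝ,
        t ^ (s - 1) * exp (-((1 + ∑ i, x i ^ 2) * t)) * ∏ i, |x i| ^ (-a i) =
          (t ^ (s - 1) * exp (-t)) * ∏ i, (|x i| ^ (-a i) * exp (-(t * x i ^ 2))) := by
      intro x
      rw [Finset.prod_mul_distrib, ← exp_sum, Finset.sum_neg_distrib, ← Finset.mul_sum,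
        show -((1 + ∑ i, x i ^ 2) * t) = -t + -(t * ∑ i, x i ^ 2) by ring, exp_add]
      ring
    have ht' : 0 ≤ t ^ (s - 1) * exp (-t) := by positivity
    simp_rw [hfac, ENNReal.ofReal_mul ht']
    rw [lintegral_const_mul' _ _ ENNReal.ofReal_ne_top,
      lintegral_pi_prod_abs_rpow_mul_exp_neg_mul_sq ha ht, ← ENNReal.ofReal_mul ht',
      ← ENNReal.ofReal_mul hP,
      show s - ∑ i, (1 - a i) / 2 - 1 = (s - 1) + -∑ i, (1 - a i) / 2 by ring, rpow_add ht]
    congr 1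
    ring

/-- Remark 4.2 (i): condition (9) for the covariance of a fractional Brownian field. -/
theorem condition9_fBf (H : ℝ) (hH : H ∈ Set.Ioo (1/2 : ℝ) 1) (d : ℕ) (hd : 1 ≤ d)
    (H' : Fin d → ℝ) (hH' : ∀ i, H' i ∈ Set.Ioo (1/2 : ℝ) 1) :
    (∫⁻ ξ : EuclideanSpace ℝ (Fin d),
        ENNReal.ofReal ((1 / (1 + ‖ξ‖ ^ 2)) ^ (2 * H) *
          ∏ i, |ξ i| ^ (-(2 * H' i - 1))) < ⊤) ↔
      (∑ i, (2 * H' i - 1)) > d - 4 * H := by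
  have hs : 0 < 2 * H := by linarith [hH.1]
  have ha : ∀ i, 2 * H' i - 1 < 1 := fun i => by linarith [(hH' i).2]
  have hG : 0 < Gamma (2 * H) := Gamma_pos_of_pos hs
  have hP : 0 < ∏ i, Gamma ((1 - (2 * H' i - 1)) / 2) :=
    Finset.prod_pos fun i _ => Gamma_pos_of_pos (by linarith [ha i])
  have mul_lt_top_iff : ∀ {c : ℝ} {x : ENNReal}, 0 < c →
      (ENNReal.ofReal c * x < ⊤ ↔ x < ⊤) := fun {c x} hc => by
    simpa [ENNReal.mul_lt_top_iff, hc.not_ge] using fun h : x = 0 => h ▸ ENNReal.zero_lt_top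
  rw [← mul_lt_top_iff hG, lintegral_one_add_norm_sq_rpow_mul_prod_abs_rpow ha hs,
    mul_lt_top_iff hP, lintegral_rpow_mul_exp_neg_Ioi_lt_top_iff, ← Finset.sum_div,
    Finset.sum_sub_distrib]
  simp only [Finset.sum_const, Finset.card_univ, Fintype.card_fin, nsmul_eq_mul, mul_one]
  constructor <;> intro h <;> linarith
end
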